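/- Let F be as in the family F₁(0): ξ = η(1+U^{1/b})^t with η discrete, P(η = aₙ) = C aₙ^{-α}, aₙ = a^{rⁿ}, r = 1+1/α, α ∈ [1/2,1), b > 0, t ≥ 1, a^r > 2^{t+2}a, U uniform on (0,1) independent of η. Then the convolution F^{*2} = F * F is long-tailed, even though F itself is not long-tailed. -/

import Mathlib

open MeasureTheory Filter Set Asymptotics

/-- Tail function of a distribution: `F̄(x) = μ(x, ∞)`. -/
noncomputable def tail (μ : Measure ℝ) (x : ℝ) : ℝ := (μ (Set.Ioi x)).toReal

/-- `F(a, b] = F(b) - F(a)`. -/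
noncomputable def intv (μ : Measure ℝ) (a b : ℝ) : ℝ := (μ (Set.Ioc a b)).toReal

/-- A distribution is long-tailed if `F̄(x+1)/F̄(x) → 1` as `x → ∞`. -/
def LongTailed (μ : Measure ℝ) : Prop :=
  Tendsto (fun x => tail μ (x + 1) / tail μ x) atTop (nhds 1)

/-- Convolution of two distributions on ℝ (law of the sum of independent rvs). -/
noncomputable def mconv (μ ν : Measure ℝ) : Measure ℝ :=
  Measure.map (fun p : ℝ × ℝ => p.1 + p.2) (μ.prod ν)

/-- `n`-fold convolution of a distribution with itself; `nconv μ 0` is the unit mass at 0. -/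
noncomputable def nconv (μ : Measure ℝ) : ℕ → Measure ℝ
  | 0 => Measure.dirac 0
  | n + 1 => mconv (nconv μ n) μ

lemma measurableSet_add_preimage {S : Set ℝ} (hS : MeasurableSet S) :
    MeasurableSet {z : ℝ × ℝ | z.1 + z.2 ∈ S} :=
  (measurable_fst.add measurable_snd) hS

lemma mconv_eq_prod (μ ν : Measure ℝ) {S : Set ℝ} (hS : MeasurableSet S) :
    mconv μ ν S = μ.prod ν {z : ℝ × ℝ | z.1 + z.2 ∈ S} := by
  rw [mconv, Measure.map_apply (by fun_prop) hS]
  rfl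

lemma mconv_apply (μ ν : Measure ℝ) [SFinite ν] {S : Set ℝ} (hS : MeasurableSet S) :
    mconv μ ν S = ∫⁻ s, ν {z | s + z ∈ S} ∂μ := by
  rw [mconv_eq_prod μ ν hS, Measure.prod_apply (measurableSet_add_preimage hS)]
  rfl

lemma mconv_swap (μ ν : Measure ℝ) [SFinite μ] [SFinite ν] : mconv μ ν = mconv ν μ := by
  change μ.conv ν = ν.conv μ
  exact Measure.conv_comm μ ν

instance isProbabilityMeasure_mconv (μ ν : Measure ℝ) [IsProbabilityMeasure μ]
    [IsProbabilityMeasure ν] : IsProbabilityMeasure (mconv μ ν) :=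
  Measure.isProbabilityMeasure_map (by fun_prop)

lemma setOf_add_mem_Ioc (s u v : ℝ) : {z : ℝ | s + z ∈ Ioc u v} = Ioc (u - s) (v - s) := by
  ext z
  simp only [mem_ofPred_eq, mem_Ioc]
  constructor <;> rintro ⟨h1, h2⟩ <;> constructor <;> linarith

lemma mconv_Ioi_ge (μ ν : Measure ℝ) [SFinite ν] {u v x : ℝ} (h : x ≤ u + v) :
    μ (Ioi u) * ν (Ioi v) ≤ mconv μ ν (Ioi x) := by
  rw [mconv_eq_prod μ ν measurableSet_Ioi, ← Measure.prod_prod]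
  refine measure_mono ?_
  rintro ⟨y, z⟩ ⟨hy, hz⟩
  simp only [mem_Ioi, mem_ofPred_eq] at *
  linarith

lemma tail_eq_intv_add_tail (μ : Measure ℝ) [IsFiniteMeasure μ] {u v : ℝ} (huv : u ≤ v) :
    tail μ u = intv μ u v + tail μ v := by
  have hdisj : Disjoint (Ioc u v) (Ioi v) :=
    Set.disjoint_left.2 fun z hz hz' => not_lt_of_ge hz.2 hz'
  rw [tail, ← Ioc_union_Ioi_eq_Ioi huv, measure_union hdisj measurableSet_Ioi,
    ENNReal.toReal_add (by finiteness) (by finiteness)]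
  rfl

lemma tendsto_measure_Ici_atTop_zero (μ : Measure ℝ) [IsFiniteMeasure μ] :
    Tendsto (fun x => μ (Ici x)) atTop (nhds 0) := by
  have h := tendsto_measure_iInter_atTop (μ := μ) (s := fun x : ℝ => Ici x)
    (fun _ => measurableSet_Ici.nullMeasurableSet) antitone_Ici ⟨0, measure_ne_top _ _⟩
  have hempty : ⋂ x : ℝ, Ici x = ∅ := eq_empty_of_forall_notMem fun z hz => by
    have := mem_Ici.1 (mem_iInter.1 hz (z + 1))
    linarith
  rwa [hempty, measure_empty] at h

/-- `F` is a mixture of laws `G n` living on the separated blocks `[a n, B * a n]`, with weights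
`p n`, and the `G n` satisfy uniform concentration bounds. -/
structure IsBlockMixture (a p ε : ℕ → ℝ) (G : ℕ → Measure ℝ) (F : Measure ℝ)
    (B w w' K c : ℝ) : Prop where
  prob : ∀ n, IsProbabilityMeasure (G n)
  prob_mixture : IsProbabilityMeasure F
  eq_sum : F = Measure.sum fun n => ENNReal.ofReal (p n) • G n
  weight_pos : ∀ n, 0 < p n
  one_le : ∀ n, 1 ≤ a n
  mem_block : ∀ n, ∀ᵐ z ∂(G n), z ∈ Icc (a n) (B * a n)
  half_le : ∀ n, ENNReal.ofReal (1 / 2) ≤ G n (Ioi (w * a n))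
  concentration : ∀ n s, G n (Ioc s (s + 1)) ≤ ENNReal.ofReal (ε n)
  concentration_upper : ∀ n s,
    G n (Ioc s (s + 1) ∩ Ioi (w' * a n)) ≤ ENNReal.ofReal (K / a n)
  le_top : ∀ n h, 0 ≤ h → h ≤ a n →
    ENNReal.ofReal (c * (h / a n)) ≤ G n (Ioi (B * a n - h))
  growth : ∀ n, 4 * B * a n ≤ a (n + 1)
  two_le : 2 ≤ B
  weight_succ : ∀ n, p (n + 1) = p n / a n
  threshold_lt : w' < w
  upper_pos : 0 < K
  top_pos : 0 < c
  error_nonneg : ∀ n, 0 ≤ ε n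

namespace IsBlockMixture

variable {a p ε : ℕ → ℝ} {G : ℕ → Measure ℝ} {F : Measure ℝ} {B w w' K c : ℝ}

lemma strictMono (h : IsBlockMixture a p ε G F B w w' K c) : StrictMono a := by
  refine strictMono_nat_of_lt_succ fun n => ?_
  nlinarith [h.growth n, h.two_le, h.one_le n]

lemma mixture_apply (h : IsBlockMixture a p ε G F B w w' K c) {S : Set ℝ}
    (hS : MeasurableSet S) : F S = ∑' n, ENNReal.ofReal (p n) * G n S := by
  conv_lhs => rw [h.eq_sum]
  rw [Measure.sum_apply _ hS]
  rfl

lemma mconv_mixture (h : IsBlockMixture a p ε G F B w w' K c) (ν : Measure ℝ) [SFinite ν]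
    {S : Set ℝ} (hS : MeasurableSet S) :
    mconv F ν S = ∑' n, ENNReal.ofReal (p n) * mconv (G n) ν S := by
  rw [mconv_apply F ν hS]
  conv_lhs => rw [h.eq_sum]
  rw [lintegral_sum_measure]
  refine tsum_congr fun n => ?_
  rw [lintegral_smul_measure, mconv_apply _ _ hS]
  rfl

lemma weight_mul_le (h : IsBlockMixture a p ε G F B w w' K c) (n : ℕ) {S : Set ℝ}
    (hS : MeasurableSet S) : ENNReal.ofReal (p n) * G n S ≤ F S := by
  rw [h.mixture_apply hS]
  exact ENNReal.le_tsum n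

lemma measure_Ioi_eq_one (h : IsBlockMixture a p ε G F B w w' K c) {n : ℕ} {x : ℝ}
    (hx : x < a n) : G n (Ioi x) = 1 := by
  have := h.prob n
  rw [← measure_univ (μ := G n)]
  refine measure_congr ?_
  filter_upwards [h.mem_block n] with z hz
  have : (Ioi x) z = (univ : Set ℝ) z := by
    refine propext ⟨fun _ => trivial, fun _ => lt_of_lt_of_le hx hz.1⟩
  exact this

lemma weight_le_tail (h : IsBlockMixture a p ε G F B w w' K c) {n : ℕ} {x : ℝ}
    (hx : x < a n) : ENNReal.ofReal (p n) ≤ F (Ioi x) := by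
  simpa [h.measure_Ioi_eq_one hx] using h.weight_mul_le n (measurableSet_Ioi (a := x))

lemma mixture_Ioi_zero (h : IsBlockMixture a p ε G F B w w' K c) : F (Ioi 0) = 1 := by
  have := h.prob_mixture
  have := h.prob
  rw [← measure_univ (μ := F), h.mixture_apply measurableSet_Ioi,
    h.mixture_apply MeasurableSet.univ]
  refine tsum_congr fun n => ?_
  rw [h.measure_Ioi_eq_one (by linarith [h.one_le n]), measure_univ]

lemma tail_le_mconv_tail (h : IsBlockMixture a p ε G F B w w' K c) (x : ℝ) :
    F (Ioi x) ≤ mconv F F (Ioi x) := by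
  have := h.prob_mixture
  simpa [h.mixture_Ioi_zero] using mconv_Ioi_ge F F (u := x) (v := 0) (x := x) (by simp)

lemma mconv_blocks_eq_zero (h : IsBlockMixture a p ε G F B w w' K c) {i j : ℕ} {S : Set ℝ}
    (hS : MeasurableSet S)
    (hdisj : ∀ y ∈ Icc (a i) (B * a i), ∀ z ∈ Icc (a j) (B * a j), y + z ∉ S) :
    mconv (G i) (G j) S = 0 := by
  have := h.prob
  rw [mconv_apply _ _ hS, lintegral_eq_zero_iff' ?_]
  · filter_upwards [h.mem_block i] with y hy
    change G j _ = 0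
    rw [measure_eq_zero_iff_ae_notMem]
    filter_upwards [h.mem_block j] with z hz
    exact hdisj y hy z hz
  · exact (measurable_measure_prodMk_left (measurableSet_add_preimage hS)).aemeasurable

/-- Only pairs of blocks involving the top block contribute to the increment of `F * F`. -/
lemma mconv_blocks_Ioc_eq_zero (h : IsBlockMixture a p ε G F B w w' K c) {k i j : ℕ} {x : ℝ}
    (hx : a (k + 1) ≤ x + 1) (hx' : x + 1 < a (k + 2)) (hi : i ≠ k + 1) (hj : j ≠ k + 1) :
    mconv (G i) (G j) (Ioc x (x + 1)) = 0 := by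
  have hB := h.two_le
  refine h.mconv_blocks_eq_zero measurableSet_Ioc ?_
  rintro y ⟨hy1, hy2⟩ z ⟨hz1, hz2⟩ ⟨h1, h2⟩
  have hai := h.one_le i
  have haj := h.one_le j
  rcases lt_or_ge (k + 1) i with hi' | hi'
  · have := h.strictMono.monotone (show k + 2 ≤ i by omega)
    linarith
  rcases lt_or_ge (k + 1) j with hj' | hj'
  · have := h.strictMono.monotone (show k + 2 ≤ j by omega)
    linarith
  have e1 := h.strictMono.monotone (show i ≤ k by omega)
  have e2 := h.strictMono.monotone (show j ≤ k by omega)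
  have e3 := h.growth k
  have e4 := h.one_le k
  have e5 : B * a i ≤ B * a k := by gcongr
  have e6 : B * a j ≤ B * a k := by gcongr
  nlinarith

lemma mconv_Ioc_le (h : IsBlockMixture a p ε G F B w w' K c) {k : ℕ} {x : ℝ}
    (hx : a (k + 1) ≤ x + 1) (hx' : x + 1 < a (k + 2)) :
    mconv F F (Ioc x (x + 1)) ≤
      2 * (ENNReal.ofReal (p (k + 1)) * mconv (G (k + 1)) F (Ioc x (x + 1))) := by
  have := h.prob
  have := h.prob_mixture
  set m := k + 1 with hm
  set I := Ioc x (x + 1) with hI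
  have hIm : MeasurableSet I := measurableSet_Ioc
  have hsum (i : ℕ) : mconv (G i) F I = ∑' j, ENNReal.ofReal (p j) * mconv (G j) (G i) I := by
    rw [mconv_swap, h.mconv_mixture _ hIm]
  have hterm (i : ℕ) : ENNReal.ofReal (p i) * mconv (G i) F I ≤
      (if i = m then ENNReal.ofReal (p m) * mconv (G m) F I else 0) +
        ENNReal.ofReal (p m) * (ENNReal.ofReal (p i) * mconv (G i) (G m) I) := by
    by_cases hi : i = m
    · simp [hi]
    · rw [if_neg hi, zero_add, hsum, tsum_eq_single m, mconv_swap (G m) (G i)]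
      · exact le_of_eq (by ring)
      · intro j hj
        rw [h.mconv_blocks_Ioc_eq_zero hx hx' hj hi, mul_zero]
  rw [h.mconv_mixture F hIm]
  calc ∑' i, ENNReal.ofReal (p i) * mconv (G i) F I
      ≤ ∑' i, ((if i = m then ENNReal.ofReal (p m) * mconv (G m) F I else 0) +
        ENNReal.ofReal (p m) * (ENNReal.ofReal (p i) * mconv (G i) (G m) I)) :=
        ENNReal.tsum_le_tsum hterm
    _ = 2 * (ENNReal.ofReal (p m) * mconv (G m) F I) := by
        rw [ENNReal.tsum_add, tsum_ite_eq, ENNReal.tsum_mul_left, ← hsum, two_mul]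

lemma mconv_Ioc_le_error (h : IsBlockMixture a p ε G F B w w' K c) (n : ℕ) (x : ℝ)
    (ν : Measure ℝ) [IsProbabilityMeasure ν] :
    mconv (G n) ν (Ioc x (x + 1)) ≤ ENNReal.ofReal (ε n) := by
  have := h.prob
  rw [mconv_swap, mconv_apply _ _ measurableSet_Ioc]
  calc ∫⁻ s, G n {z | s + z ∈ Ioc x (x + 1)} ∂ν
      ≤ ∫⁻ _, ENNReal.ofReal (ε n) ∂ν := by
        refine lintegral_mono fun s => ?_
        rw [setOf_add_mem_Ioc, add_sub_right_comm]
        exact h.concentration n _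
    _ = ENNReal.ofReal (ε n) := by simp

lemma mconv_self_Ioc_le (h : IsBlockMixture a p ε G F B w w' K c) {n : ℕ} {x : ℝ}
    (hx : 2 * w * a n ≤ x) :
    mconv (G n) (G n) (Ioc x (x + 1)) ≤ 2 * ENNReal.ofReal (K / a n) := by
  have := h.prob
  have ha := h.one_le n
  have hw := h.threshold_lt
  have hwa : w' * a n ≤ w * a n := by gcongr
  have hsec (s : ℝ) : G n {z | s + z ∈ Ioc x (x + 1) ∧ w * a n < z} ≤
      ENNReal.ofReal (K / a n) := by
    refine (measure_mono ?_).trans (h.concentration_upper n (x - s))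
    rintro z ⟨⟨h1, h2⟩, h3⟩
    exact ⟨⟨by linarith, by linarith⟩, mem_Ioi.2 (by linarith)⟩
  have hM : MeasurableSet {z : ℝ × ℝ | z.1 + z.2 ∈ Ioc x (x + 1) ∧ w * a n < z.2} :=
    (measurableSet_add_preimage measurableSet_Ioc).inter (measurable_snd measurableSet_Ioi)
  have hM' : MeasurableSet {z : ℝ × ℝ | z.2 + z.1 ∈ Ioc x (x + 1) ∧ w * a n < z.1} :=
    hM.preimage measurable_swap
  rw [mconv_eq_prod _ _ measurableSet_Ioc]
  calc (G n).prod (G n) {z : ℝ × ℝ | z.1 + z.2 ∈ Ioc x (x + 1)}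
      ≤ (G n).prod (G n) ({z : ℝ × ℝ | z.1 + z.2 ∈ Ioc x (x + 1) ∧ w * a n < z.2} ∪
          {z : ℝ × ℝ | z.2 + z.1 ∈ Ioc x (x + 1) ∧ w * a n < z.1}) := by
        refine measure_mono ?_
        intro z hz
        have hz' : z.1 + z.2 ∈ Ioc x (x + 1) := hz
        by_cases h2 : w * a n < z.2
        · exact Or.inl ⟨hz', h2⟩
        · refine Or.inr ⟨by rwa [add_comm z.2 z.1], ?_⟩
          have := hz'.1
          linarith
    _ ≤ ENNReal.ofReal (K / a n) + ENNReal.ofReal (K / a n) := by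
        refine (measure_union_le _ _).trans (add_le_add ?_ ?_)
        · rw [Measure.prod_apply hM]
          calc _ ≤ ∫⁻ _, ENNReal.ofReal (K / a n) ∂(G n) := lintegral_mono fun s => hsec s
            _ = _ := by simp
        · rw [Measure.prod_apply_symm hM']
          calc _ ≤ ∫⁻ _, ENNReal.ofReal (K / a n) ∂(G n) := lintegral_mono fun s => hsec s
            _ = _ := by simp
    _ = _ := by rw [two_mul]

lemma mconv_block_Ioc_le (h : IsBlockMixture a p ε G F B w w' K c) {k : ℕ} {x : ℝ}
    (hx : w * a (k + 1) ≤ x) (hx' : x + 1 < a (k + 2))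
    (hk : B * a k ≤ (w - w') * a (k + 1)) :
    mconv (G (k + 1)) F (Ioc x (x + 1)) ≤
      ENNReal.ofReal (p (k + 1)) * mconv (G (k + 1)) (G (k + 1)) (Ioc x (x + 1)) +
        ENNReal.ofReal (K / a (k + 1)) * F (Ici (x - B * a (k + 1))) := by
  have := h.prob
  have := h.prob_mixture
  have hB := h.two_le
  set m := k + 1 with hm
  have hterm (j : ℕ) : ENNReal.ofReal (p j) * mconv (G j) (G m) (Ioc x (x + 1)) ≤
      (if j = m then ENNReal.ofReal (p m) * mconv (G m) (G m) (Ioc x (x + 1)) else 0) +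
        ENNReal.ofReal (K / a m) * (ENNReal.ofReal (p j) * G j (Ici (x - B * a m))) := by
    rcases lt_trichotomy j m with hj | hj | hj
    · rw [if_neg hj.ne, zero_add, mul_left_comm]
      gcongr
      rw [mconv_apply _ _ measurableSet_Ioc, ← lintegral_indicator_const measurableSet_Ici]
      refine lintegral_mono_ae ?_
      filter_upwards [h.mem_block j] with s hs
      rw [setOf_add_mem_Ioc, add_sub_right_comm]
      have hsk : B * a j ≤ B * a k := by
        have := h.strictMono.monotone (show j ≤ k by omega)
        gcongr
      by_cases hsy : s ∈ Ici (x - B * a m)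
      · rw [indicator_of_mem hsy]
        refine (measure_mono ?_).trans (h.concentration_upper m (x - s))
        intro z hz
        refine ⟨hz, mem_Ioi.2 ?_⟩
        have := hz.1
        have := hs.2
        linarith
      · rw [indicator_of_notMem hsy, nonpos_iff_eq_zero, measure_eq_zero_iff_ae_notMem]
        filter_upwards [h.mem_block m] with z hz hz'
        have := hz'.1
        have := hz.2
        have := mem_Ici.not.1 hsy
        linarith
    · simp [hj]
    · rw [h.mconv_blocks_eq_zero measurableSet_Ioc, mul_zero]
      · exact zero_le
      · rintro y hy z hz ⟨_, h2⟩
        have e1 := h.strictMono.monotone (show k + 2 ≤ j by omega)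
        have := hy.1
        have := hz.1
        have := h.one_le m
        linarith
  rw [mconv_swap, h.mconv_mixture _ measurableSet_Ioc, h.mixture_apply measurableSet_Ici]
  refine (ENNReal.tsum_le_tsum hterm).trans (le_of_eq ?_)
  rw [ENNReal.tsum_add, tsum_ite_eq, ENNReal.tsum_mul_left]

lemma mconv_tail_lower_bounds (h : IsBlockMixture a p ε G F B w w' K c) {k : ℕ} {x : ℝ} :
    (x < a (k + 2) → p (k + 2) ≤ tail (mconv F F) x) ∧
    (x ≤ w * a (k + 1) → p (k + 1) / 2 ≤ tail (mconv F F) x) ∧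
    (x ≤ 2 * w * a (k + 1) → (p (k + 1) / 2) ^ 2 ≤ tail (mconv F F) x) ∧
    (x ≤ B * a (k + 1) + a k / 4 →
      c / 4 * p (k + 2) * (p k * a k) ≤ tail (mconv F F) x) := by
  have := h.prob
  have := h.prob_mixture
  have hhalf : ENNReal.ofReal (p (k + 1) / 2) ≤ F (Ioi (w * a (k + 1))) := by
    refine le_trans ?_ (h.weight_mul_le (k + 1) measurableSet_Ioi)
    rw [div_eq_mul_one_div, ENNReal.ofReal_mul (h.weight_pos _).le]
    gcongr
    exact h.half_le _
  have key {y : ℝ} (hy : ENNReal.ofReal y ≤ mconv F F (Ioi x)) : y ≤ tail (mconv F F) x :=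
    (ENNReal.ofReal_le_iff_le_toReal (measure_ne_top _ _)).1 hy
  refine ⟨fun hx => key ?_, fun hx => key ?_, fun hx => key ?_, fun hx => key ?_⟩
  · exact (h.weight_le_tail hx).trans (h.tail_le_mconv_tail x)
  · exact (hhalf.trans (measure_mono (Ioi_subset_Ioi hx))).trans (h.tail_le_mconv_tail x)
  · have := h.weight_pos (k + 1)
    rw [pow_two, ENNReal.ofReal_mul (by positivity)]
    exact (mul_le_mul' hhalf hhalf).trans (mconv_Ioi_ge F F (by linarith))
  · have hk := h.one_le k
    have hm := h.one_le (k + 1)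
    have hkm := h.strictMono (show k < k + 1 by omega)
    have h1 : ENNReal.ofReal (p (k + 1) * (c * (a k / 4 / a (k + 1)))) ≤
        F (Ioi (B * a (k + 1) - a k / 4)) := by
      refine le_trans ?_ (h.weight_mul_le (k + 1) measurableSet_Ioi)
      rw [ENNReal.ofReal_mul (h.weight_pos _).le]
      gcongr
      exact h.le_top _ _ (by linarith) (by linarith)
    have h2 : ENNReal.ofReal (p k) ≤ F (Ioi (a k / 2)) := h.weight_le_tail (by linarith)
    have e : c / 4 * p (k + 2) * (p k * a k) =
        p (k + 1) * (c * (a k / 4 / a (k + 1))) * p k := by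
      rw [h.weight_succ (k + 1)]
      ring
    rw [e, ENNReal.ofReal_mul' (h.weight_pos k).le]
    exact (mul_le_mul' h1 h2).trans (mconv_Ioi_ge F F (by linarith))

lemma mconv_increment_le (h : IsBlockMixture a p ε G F B w w' K c) {k : ℕ} {x : ℝ}
    (hx : a (k + 1) ≤ x + 1) (hx' : x + 1 < a (k + 2))
    (hk : B * a k ≤ (w - w') * a (k + 1)) :
    intv (mconv F F) x (x + 1) ≤
      (12 * ε (k + 1) + 4 * K * p (k + 1) + 2 * K * (F (Ici (a k / 4))).toReal
        + 8 * K / (c * (p k * a k))) * tail (mconv F F) x := by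
  have := h.prob
  have := h.prob_mixture
  obtain ⟨t1, t2, t3, t4⟩ := h.mconv_tail_lower_bounds (k := k) (x := x)
  specialize t1 (by linarith)
  set T := tail (mconv F F) x
  have hp := h.weight_pos (k + 1)
  have hp0 := h.weight_pos k
  have hp2 := h.weight_pos (k + 2)
  have hε := h.error_nonneg (k + 1)
  have hK := h.upper_pos
  have hc := h.top_pos
  have ha := h.one_le (k + 1)
  have ha0 := h.one_le k
  have hsucc := h.weight_succ (k + 1)
  have hT : 0 < T := hp2.trans_le t1
  have hS : 0 < c * (p k * a k) := by positivity
  set X := (mconv (G (k + 1)) F (Ioc x (x + 1))).toReal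
  set D := (mconv (G (k + 1)) (G (k + 1)) (Ioc x (x + 1))).toReal
  set f := (F (Ici (x - B * a (k + 1)))).toReal
  set f' := (F (Ici (a k / 4))).toReal
  have hD0 : 0 ≤ D := ENNReal.toReal_nonneg
  have hf0 : 0 ≤ f := ENNReal.toReal_nonneg
  have hf0' : 0 ≤ f' := ENNReal.toReal_nonneg
  have hf1 : f ≤ 1 := ENNReal.toReal_mono ENNReal.one_ne_top prob_le_one
  have n1 : intv (mconv F F) x (x + 1) ≤ 2 * (p (k + 1) * X) := by
    have := ENNReal.toReal_mono (by finiteness) (h.mconv_Ioc_le hx hx')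
    rwa [ENNReal.toReal_mul, ENNReal.toReal_mul, ENNReal.toReal_ofReal hp.le] at this
  have n2 : X ≤ ε (k + 1) := by
    have := ENNReal.toReal_mono (by finiteness) (h.mconv_Ioc_le_error (k + 1) x F)
    rwa [ENNReal.toReal_ofReal hε] at this
  have n3 : D ≤ ε (k + 1) := by
    have := ENNReal.toReal_mono (by finiteness) (h.mconv_Ioc_le_error (k + 1) x (G (k + 1)))
    rwa [ENNReal.toReal_ofReal hε] at this
  have hrest : 0 ≤ 8 * K / (c * (p k * a k)) := by positivity
  rcases le_or_gt x (w * a (k + 1)) with hw | hw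
  · have := t2 hw
    calc intv (mconv F F) x (x + 1) ≤ 2 * (p (k + 1) * ε (k + 1)) := n1.trans (by gcongr)
      _ = 4 * ε (k + 1) * (p (k + 1) / 2) := by ring
      _ ≤ 4 * ε (k + 1) * T := by gcongr
      _ ≤ _ := by
        gcongr
        have : 0 ≤ 4 * K * p (k + 1) := by positivity
        have : 0 ≤ 2 * K * f' := by positivity
        linarith
  have n4 : X ≤ p (k + 1) * D + K / a (k + 1) * f := by
    have := ENNReal.toReal_mono (by finiteness) (h.mconv_block_Ioc_le hw.le hx' hk)
    rwa [ENNReal.toReal_add (by finiteness) (by finiteness), ENNReal.toReal_mul,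
      ENNReal.toReal_mul, ENNReal.toReal_ofReal hp.le,
      ENNReal.toReal_ofReal (by positivity)] at this
  have e1 : 2 * p (k + 1) ^ 2 * D ≤ (8 * ε (k + 1) + 4 * K * p (k + 1)) * T := by
    rcases le_or_gt x (2 * w * a (k + 1)) with hw2 | hw2
    · calc 2 * p (k + 1) ^ 2 * D ≤ 2 * p (k + 1) ^ 2 * ε (k + 1) := by gcongr
        _ = 8 * ε (k + 1) * (p (k + 1) / 2) ^ 2 := by ring
        _ ≤ 8 * ε (k + 1) * T := by gcongr; exact t3 hw2
        _ ≤ _ := by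
          gcongr
          have : 0 ≤ 4 * K * p (k + 1) := by positivity
          linarith
    · have n5 : D ≤ 2 * (K / a (k + 1)) := by
        have := ENNReal.toReal_mono (by finiteness) (h.mconv_self_Ioc_le hw2.le)
        rwa [ENNReal.toReal_mul, ENNReal.toReal_ofReal (by positivity)] at this
      calc 2 * p (k + 1) ^ 2 * D ≤ 2 * p (k + 1) ^ 2 * (2 * (K / a (k + 1))) := by gcongr
        _ = 4 * K * p (k + 1) * p (k + 2) := by rw [hsucc]; ring
        _ ≤ 4 * K * p (k + 1) * T := by gcongr
        _ ≤ _ := by gcongr; linarith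
  have e2 : 2 * K * p (k + 2) * f ≤ (2 * K * f' + 8 * K / (c * (p k * a k))) * T := by
    rcases le_or_gt x (B * a (k + 1) + a k / 4) with hy | hy
    · calc 2 * K * p (k + 2) * f ≤ 2 * K * p (k + 2) * 1 := by gcongr
        _ = 8 * K / (c * (p k * a k)) * (c / 4 * p (k + 2) * (p k * a k)) := by
          field_simp; ring
        _ ≤ 8 * K / (c * (p k * a k)) * T := by gcongr; exact t4 hy
        _ ≤ _ := by
          gcongr
          have : 0 ≤ 2 * K * f' := by positivity
          linarith
    · have hff : f ≤ f' :=
        ENNReal.toReal_mono (by finiteness) (measure_mono (Ici_subset_Ici.2 (by linarith)))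
      calc 2 * K * p (k + 2) * f ≤ 2 * K * T * f' := by gcongr
        _ = 2 * K * f' * T := by ring
        _ ≤ _ := by gcongr; linarith
  calc intv (mconv F F) x (x + 1)
      ≤ 2 * (p (k + 1) * (p (k + 1) * D + K / a (k + 1) * f)) := n1.trans (by gcongr)
    _ = 2 * p (k + 1) ^ 2 * D + 2 * K * p (k + 2) * f := by rw [hsucc]; ring
    _ ≤ (8 * ε (k + 1) + 4 * K * p (k + 1)) * T
        + (2 * K * f' + 8 * K / (c * (p k * a k))) * T := add_le_add e1 e2
    _ ≤ _ := by nlinarith [mul_nonneg hε hT.le]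

lemma longTailed_mconv (h : IsBlockMixture a p ε G F B w w' K c)
    (ha : Tendsto a atTop atTop) (hratio : Tendsto (fun n => a n / a (n + 1)) atTop (nhds 0))
    (hp : Tendsto p atTop (nhds 0)) (hpa : Tendsto (fun n => p n * a n) atTop atTop)
    (hε : Tendsto ε atTop (nhds 0)) : LongTailed (mconv F F) := by
  have := h.prob_mixture
  set δ : ℕ → ℝ := fun k => 12 * ε (k + 1) + 4 * K * p (k + 1)
    + 2 * K * (F (Ici (a k / 4))).toReal + 8 * K / (c * (p k * a k)) with hδdef
  have hδ : Tendsto δ atTop (nhds 0) := by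
    have s1 := (hε.comp (tendsto_add_atTop_nat 1)).const_mul 12
    have s2 := (hp.comp (tendsto_add_atTop_nat 1)).const_mul (4 * K)
    have s3 : Tendsto (fun k => 2 * K * (F (Ici (a k / 4))).toReal) atTop (nhds 0) := by
      have hF0 : Tendsto (fun k => F (Ici (a k / 4))) atTop (nhds 0) :=
        (tendsto_measure_Ici_atTop_zero F).comp (ha.atTop_div_const (by norm_num))
      simpa using ((ENNReal.tendsto_toReal ENNReal.zero_ne_top).comp hF0).const_mul (2 * K)
    have s4 : Tendsto (fun k => 8 * K / (c * (p k * a k))) atTop (nhds 0) :=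
      (hpa.const_mul_atTop h.top_pos).const_div_atTop _
    simpa [hδdef, Function.comp_def] using ((s1.add s2).add s3).add s4
  have hev : ∀ᶠ k in atTop, B * a k ≤ (w - w') * a (k + 1) := by
    have hB := h.two_le
    have hw := h.threshold_lt
    have hpos : 0 < (w - w') / B := div_pos (by linarith) (by linarith)
    filter_upwards [hratio.eventually (gt_mem_nhds hpos)] with k hk
    have := h.one_le (k + 1)
    rw [div_lt_div_iff₀ (by linarith) (by linarith)] at hk
    linarith
  rw [LongTailed, Metric.tendsto_atTop]
  intro e he
  obtain ⟨k₀, hk₀⟩ := eventually_atTop.1 (hev.and (hδ.eventually (gt_mem_nhds he)))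
  refine ⟨a (k₀ + 1), fun x hx => ?_⟩
  have hex : ∃ n, x + 1 < a n := (ha.eventually_gt_atTop _).exists
  classical
  set n := Nat.find hex with hn
  have hn1 : x + 1 < a n := Nat.find_spec hex
  have hn2 : k₀ + 1 < n := by
    refine h.strictMono.lt_iff_lt.1 (lt_of_le_of_lt hx ?_)
    linarith
  obtain ⟨k, hk⟩ : ∃ k, n = k + 2 := ⟨n - 2, by omega⟩
  have hk1 : a (k + 1) ≤ x + 1 := not_lt.1 (Nat.find_min hex (m := k + 1) (by omega))
  rw [hk] at hn1
  obtain ⟨hw, hd⟩ := hk₀ k (by omega)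
  have hN : intv (mconv F F) x (x + 1) ≤ δ k * tail (mconv F F) x :=
    h.mconv_increment_le hk1 hn1 hw
  have hT : 0 < tail (mconv F F) x :=
    (h.weight_pos (k + 2)).trans_le (h.mconv_tail_lower_bounds.1 (by linarith))
  have hN0 : 0 ≤ intv (mconv F F) x (x + 1) := ENNReal.toReal_nonneg
  have hsplit := tail_eq_intv_add_tail (mconv F F) (show x ≤ x + 1 by linarith)
  have heq : tail (mconv F F) (x + 1) / tail (mconv F F) x - 1 =
      -(intv (mconv F F) x (x + 1) / tail (mconv F F) x) := by
    field_simp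
    linarith
  rw [Real.dist_eq, heq, abs_neg, abs_of_nonneg (by positivity)]
  exact lt_of_le_of_lt ((div_le_iff₀ hT).2 hN) hd

lemma tail_block_end_le (h : IsBlockMixture a p ε G F B w w' K c) (n : ℕ) :
    tail F (B * a n) ≤ 2 * p (n + 1) := by
  have := h.prob
  have hB := h.two_le
  have hdecay (k : ℕ) : p (k + (n + 1)) ≤ p (n + 1) * (1 / 2) ^ k := by
    induction k with
    | zero => simp
    | succ k ih =>
      have h1 := h.one_le (k + n)
      have h2 := h.growth (k + n)
      have h3 : 2 ≤ a (k + (n + 1)) := by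
        rw [← add_assoc]
        nlinarith
      rw [show k + 1 + (n + 1) = k + (n + 1) + 1 by ring, h.weight_succ, pow_succ, ← mul_assoc,
        mul_one_div]
      have := h.weight_pos (n + 1)
      gcongr
  have hle : F (Ioi (B * a n)) ≤ ENNReal.ofReal (p (n + 1)) * 2 := by
    rw [h.mixture_apply measurableSet_Ioi, ← ENNReal.summable.sum_add_tsum_nat_add' (k := n + 1),
      Finset.sum_eq_zero, zero_add]
    · calc ∑' k, ENNReal.ofReal (p (k + (n + 1))) * G (k + (n + 1)) (Ioi (B * a n))
          ≤ ∑' k, ENNReal.ofReal (p (n + 1)) * 2⁻¹ ^ k := by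
            refine ENNReal.tsum_le_tsum fun k => ?_
            calc _ ≤ ENNReal.ofReal (p (n + 1) * (1 / 2) ^ k) * 1 := by
                  gcongr
                  · exact hdecay k
                  · exact prob_le_one
              _ = _ := by
                  rw [mul_one, ENNReal.ofReal_mul (h.weight_pos _).le,
                    ENNReal.ofReal_pow (by norm_num), one_div,
                    ENNReal.ofReal_inv_of_pos (by norm_num), ENNReal.ofReal_ofNat]
        _ = _ := by
          rw [ENNReal.tsum_mul_left, ENNReal.tsum_geometric, ENNReal.one_sub_inv_two, inv_inv]
    · intro j hj
      have hjn := h.strictMono.monotone (show j ≤ n by have := Finset.mem_range.1 hj; omega)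
      rw [mul_eq_zero]
      right
      rw [measure_eq_zero_iff_ae_notMem]
      filter_upwards [h.mem_block j] with z hz hz'
      have : B * a j ≤ B * a n := by gcongr
      exact absurd (hz.2.trans this) (not_le.2 hz')
  have := ENNReal.toReal_mono (by finiteness) hle
  rw [ENNReal.toReal_mul, ENNReal.toReal_ofReal (h.weight_pos _).le, ENNReal.toReal_ofNat] at this
  rw [tail]
  linarith

lemma le_intv_block_end (h : IsBlockMixture a p ε G F B w w' K c) (n : ℕ) :
    c * p (n + 1) ≤ intv F (B * a n - 1) (B * a n) := by
  have := h.prob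
  have := h.prob_mixture
  have hsame : G n (Ioc (B * a n - 1) (B * a n)) = G n (Ioi (B * a n - 1)) := by
    refine measure_congr ?_
    filter_upwards [h.mem_block n] with z hz
    exact propext ⟨fun hz' => hz'.1, fun hz' => ⟨hz', hz.2⟩⟩
  have e : c * p (n + 1) = p n * (c * (1 / a n)) := by
    rw [h.weight_succ]
    ring
  rw [intv, ← ENNReal.ofReal_le_iff_le_toReal (measure_ne_top _ _), e,
    ENNReal.ofReal_mul (h.weight_pos n).le]
  refine le_trans ?_ (h.weight_mul_le n measurableSet_Ioc)
  rw [hsame]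
  gcongr
  exact h.le_top n 1 zero_le_one (h.one_le n)

lemma not_longTailed (h : IsBlockMixture a p ε G F B w w' K c)
    (ha : Tendsto a atTop atTop) : ¬ LongTailed F := by
  intro hlt
  have := h.prob_mixture
  have hc := h.top_pos
  have hlim : Tendsto (fun n => B * a n - 1) atTop atTop :=
    tendsto_atTop_add_const_right _ _ (ha.const_mul_atTop (by linarith [h.two_le]))
  have hle : (1 : ℝ) ≤ 2 / (2 + c) := by
    refine le_of_tendsto (hlt.comp hlim) (Eventually.of_forall fun n => ?_)
    have h1 := h.tail_block_end_le n
    have h2 := h.le_intv_block_end n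
    have h3 := tail_eq_intv_add_tail F (show B * a n - 1 ≤ B * a n by linarith)
    have h4 := h.weight_pos (n + 1)
    have h5 : 0 ≤ tail F (B * a n) := ENNReal.toReal_nonneg
    simp only [Function.comp_apply, sub_add_cancel]
    rw [div_le_div_iff₀ (by nlinarith) (by linarith)]
    nlinarith
  rw [le_div_iff₀ (by linarith)] at hle
  linarith

end IsBlockMixture

/-- The increasing map `u ↦ (1 + u ^ (1 / b)) ^ t` of `[0, 1]` onto `[1, 2 ^ t]`. -/
noncomputable def profile (b t u : ℝ) : ℝ := (1 + u ^ (1 / b)) ^ t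

lemma measurable_profile (b t : ℝ) : Measurable (profile b t) := by
  unfold profile
  fun_prop

lemma profile_one (b t : ℝ) : profile b t 1 = 2 ^ t := by
  simp only [profile, Real.one_rpow]
  norm_num

lemma profile_mono {b t u v : ℝ} (hb : 0 < b) (ht : 1 ≤ t) (hu : 0 ≤ u) (huv : u ≤ v) :
    profile b t u ≤ profile b t v := by
  unfold profile
  have : 0 ≤ u ^ (1 / b) := Real.rpow_nonneg hu _
  gcongr

lemma one_le_profile {b t u : ℝ} (ht : 1 ≤ t) (hu : 0 ≤ u) : 1 ≤ profile b t u :=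
  Real.one_le_rpow (by linarith [Real.rpow_nonneg hu (1 / b)]) (by linarith)

lemma exists_profile_slope_bounds {b t u₀ : ℝ} (hb : 0 < b) (ht : 1 ≤ t) (hu₀ : 0 < u₀)
    (hu₀' : u₀ ≤ 1) :
    ∃ c L : ℝ, 0 < c ∧ ∀ u v, u₀ ≤ u → u ≤ v → v ≤ 1 →
      c * (v - u) ≤ profile b t v - profile b t u ∧
      profile b t v - profile b t u ≤ L * (v - u) := by
  set d : ℝ → ℝ := fun u => 1 / b * u ^ (1 / b - 1) * t * (1 + u ^ (1 / b)) ^ (t - 1) with hd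
  have hderiv : ∀ u, 0 < u → HasDerivAt (profile b t) (d u) u := by
    intro u hu
    have h1 : HasDerivAt (fun u : ℝ => 1 + u ^ (1 / b)) (1 / b * u ^ (1 / b - 1)) u :=
      (Real.hasDerivAt_rpow_const (Or.inl hu.ne')).const_add 1
    have : 0 < u ^ (1 / b) := Real.rpow_pos_of_pos hu _
    exact h1.rpow_const (Or.inl (by linarith))
  have hdpos : ∀ u, 0 < u → 0 < d u := by
    intro u hu
    have : 0 < u ^ (1 / b) := Real.rpow_pos_of_pos hu _
    have : 0 < u ^ (1 / b - 1) := Real.rpow_pos_of_pos hu _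
    have : 0 < (1 + u ^ (1 / b)) ^ (t - 1) := Real.rpow_pos_of_pos (by linarith) _
    positivity
  have hcont : ContinuousOn d (Icc u₀ 1) := by
    intro u hu
    have hu' : 0 < u := hu₀.trans_le hu.1
    have : 0 < u ^ (1 / b) := Real.rpow_pos_of_pos hu' _
    refine ContinuousAt.continuousWithinAt ?_
    refine ((continuousAt_const.mul ?_).mul continuousAt_const).mul ?_
    · exact Real.continuousAt_rpow_const _ _ (Or.inl hu'.ne')
    · exact (continuousAt_const.add (Real.continuousAt_rpow_const _ _ (Or.inl hu'.ne'))).rpow_const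
        (Or.inl (show 1 + u ^ (1 / b) ≠ 0 by linarith))
  have hne : (Icc u₀ 1).Nonempty := nonempty_Icc.2 hu₀'
  obtain ⟨m, hm, hmin⟩ := isCompact_Icc.exists_isMinOn hne hcont
  obtain ⟨M, hM, hmax⟩ := isCompact_Icc.exists_isMaxOn hne hcont
  have hdiff : ∀ u ∈ Icc u₀ 1, DifferentiableAt ℝ (profile b t) u := fun u hu =>
    (hderiv u (hu₀.trans_le hu.1)).differentiableAt
  have hc : ContinuousOn (profile b t) (Icc u₀ 1) := fun u hu =>
    (hdiff u hu).continuousAt.continuousWithinAt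
  have hdo : DifferentiableOn ℝ (profile b t) (interior (Icc u₀ 1)) := fun u hu =>
    (hdiff u (interior_subset hu)).differentiableWithinAt
  refine ⟨d m, d M, hdpos m (hu₀.trans_le hm.1), fun u v hu huv hv => ⟨?_, ?_⟩⟩
  · refine (convex_Icc u₀ 1).mul_sub_le_image_sub_of_le_deriv hc hdo (fun x hx => ?_) u
      ⟨hu, huv.trans hv⟩ v ⟨hu.trans huv, hv⟩ huv
    have hx' := interior_subset hx
    rw [(hderiv x (hu₀.trans_le hx'.1)).deriv]
    exact hmin hx'
  · refine (convex_Icc u₀ 1).image_sub_le_mul_sub_of_deriv_le hc hdo (fun x hx => ?_) u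
      ⟨hu, huv.trans hv⟩ v ⟨hu.trans huv, hv⟩ huv
    have hx' := interior_subset hx
    rw [(hderiv x (hu₀.trans_le hx'.1)).deriv]
    exact hmax hx'

/-- The law of `A * (1 + U ^ (1 / b)) ^ t` for `U` uniform on `(0, 1)`. -/
noncomputable def blockLaw (b t A : ℝ) : Measure ℝ :=
  Measure.map (fun u => A * profile b t u) (volume.restrict (Ioo (0 : ℝ) 1))

instance isProbabilityMeasure_uniform :
    IsProbabilityMeasure (volume.restrict (Ioo (0 : ℝ) 1)) :=
  ⟨by simp⟩

lemma blockLaw_apply (b t A : ℝ) {S : Set ℝ} (hS : MeasurableSet S) :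
    blockLaw b t A S = volume ({u | A * profile b t u ∈ S} ∩ Ioo 0 1) := by
  have hm : Measurable fun u => A * profile b t u := (measurable_profile b t).const_mul A
  rw [blockLaw, Measure.map_apply hm hS, Measure.restrict_apply (hm hS)]
  rfl

instance isProbabilityMeasure_blockLaw (b t A : ℝ) : IsProbabilityMeasure (blockLaw b t A) :=
  Measure.isProbabilityMeasure_map ((measurable_profile b t).const_mul A).aemeasurable

lemma ae_mem_blockLaw {b t A : ℝ} (hb : 0 < b) (ht : 1 ≤ t) (hA : 0 < A) :
    ∀ᵐ z ∂(blockLaw b t A), z ∈ Icc A (2 ^ t * A) := by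
  refine (ae_map_iff ((measurable_profile b t).const_mul A).aemeasurable measurableSet_Icc).2 ?_
  filter_upwards [ae_restrict_mem measurableSet_Ioo] with u hu
  have h1 := one_le_profile (b := b) ht hu.1.le
  have h2 := profile_mono hb ht hu.1.le hu.2.le
  rw [profile_one] at h2
  exact ⟨le_mul_of_one_le_right hA.le h1, by rw [mul_comm]; gcongr⟩

lemma half_le_blockLaw {b t A : ℝ} (hb : 0 < b) (ht : 1 ≤ t) (hA : 0 < A) :
    ENNReal.ofReal (1 / 2) ≤ blockLaw b t A (Ioi (profile b t (1 / 2) * A)) := by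
  obtain ⟨c, L, hc, hcL⟩ := exists_profile_slope_bounds hb ht (u₀ := 1 / 2)
    (by norm_num) (by norm_num)
  rw [blockLaw_apply _ _ _ measurableSet_Ioi]
  calc ENNReal.ofReal (1 / 2) = volume (Ioo (1 / 2 : ℝ) 1) := by
        rw [Real.volume_Ioo]; norm_num
    _ ≤ _ := by
      refine measure_mono fun u hu => ⟨?_, by linarith [hu.1], hu.2⟩
      have h1 := (hcL (1 / 2) u le_rfl hu.1.le hu.2.le).1
      have h2 : 0 < c * (u - 1 / 2) := mul_pos hc (by linarith [hu.1])
      change profile b t (1 / 2) * A < A * profile b t u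
      nlinarith

/-- On the part of the block where the profile has slope at least `c`, unit intervals carry mass
at most `1 / (c * A)`. -/
lemma volume_profile_preimage_le {b t A c u₀ : ℝ} (hA : 0 < A) (hc : 0 < c)
    (hslope : ∀ u v, u₀ ≤ u → u ≤ v → v ≤ 1 → c * (v - u) ≤ profile b t v - profile b t u)
    (s : ℝ) :
    volume ({u | A * profile b t u ∈ Ioc s (s + 1)} ∩ Icc u₀ 1) ≤
      ENNReal.ofReal (1 / c / A) := by
  have key : ∀ u ∈ {u | A * profile b t u ∈ Ioc s (s + 1)} ∩ Icc u₀ 1,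
      ∀ v ∈ {u | A * profile b t u ∈ Ioc s (s + 1)} ∩ Icc u₀ 1, u ≤ v → v - u ≤ 1 / c / A := by
    rintro u ⟨⟨hu1, hu2⟩, hu⟩ v ⟨⟨hv1, hv2⟩, hv⟩ huv
    have h1 := hslope u v hu.1 huv hv.2
    rw [div_div, le_div_iff₀ (by positivity)]
    nlinarith
  refine (Real.volume_le_diam _).trans (Metric.ediam_le fun u hu v hv => ?_)
  rw [edist_dist, Real.dist_eq]
  refine ENNReal.ofReal_le_ofReal (abs_le.2 ?_)
  rcases le_total u v with huv | huv
  · have h1 := key u hu v hv huv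
    constructor <;> linarith
  · have h1 := key v hv u hu huv
    constructor <;> linarith

lemma blockLaw_upper_le {b t A c u₀ : ℝ} (hb : 0 < b) (ht : 1 ≤ t) (hA : 0 < A) (hc : 0 < c)
    (hslope : ∀ u v, u₀ ≤ u → u ≤ v → v ≤ 1 → c * (v - u) ≤ profile b t v - profile b t u)
    (s : ℝ) :
    blockLaw b t A (Ioc s (s + 1) ∩ Ioi (profile b t u₀ * A)) ≤ ENNReal.ofReal (1 / c / A) := by
  rw [blockLaw_apply _ _ _ (measurableSet_Ioc.inter measurableSet_Ioi)]
  refine (measure_mono ?_).trans (volume_profile_preimage_le hA hc hslope s)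
  rintro u ⟨⟨hu1, hu2⟩, hu3⟩
  refine ⟨hu1, ?_, hu3.2.le⟩
  by_contra! hlt
  have := profile_mono hb ht hu3.1.le hlt.le
  have h2 : profile b t u₀ * A < A * profile b t u := hu2
  nlinarith

lemma blockLaw_Ioc_le {b t A c u₀ : ℝ} (hA : 0 < A) (hc : 0 < c) (hu₀ : 0 ≤ u₀)
    (hslope : ∀ u v, u₀ ≤ u → u ≤ v → v ≤ 1 → c * (v - u) ≤ profile b t v - profile b t u)
    (s : ℝ) : blockLaw b t A (Ioc s (s + 1)) ≤ ENNReal.ofReal (u₀ + 1 / c / A) := by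
  rw [blockLaw_apply _ _ _ measurableSet_Ioc, ENNReal.ofReal_add hu₀ (by positivity)]
  calc volume ({u | A * profile b t u ∈ Ioc s (s + 1)} ∩ Ioo 0 1)
      ≤ volume (Ioo 0 u₀ ∪ {u | A * profile b t u ∈ Ioc s (s + 1)} ∩ Icc u₀ 1) := by
        refine measure_mono fun u ⟨hu1, hu2⟩ => ?_
        rcases lt_or_ge u u₀ with hu | hu
        · exact Or.inl ⟨hu2.1, hu⟩
        · exact Or.inr ⟨hu1, hu, hu2.2.le⟩
    _ ≤ ENNReal.ofReal u₀ + ENNReal.ofReal (1 / c / A) := by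
        refine (measure_union_le _ _).trans (add_le_add ?_ ?_)
        · rw [Real.volume_Ioo, sub_zero]
        · exact volume_profile_preimage_le hA hc hslope s

lemma le_blockLaw_top {b t A L h : ℝ} (hA : 0 < A) (hL : 2 ≤ L)
    (hslope : ∀ u, 1 / 2 ≤ u → u ≤ 1 → 2 ^ t - profile b t u ≤ L * (1 - u))
    (hh : 0 ≤ h) (hhA : h ≤ A) :
    ENNReal.ofReal (1 / L * (h / A)) ≤ blockLaw b t A (Ioi (2 ^ t * A - h)) := by
  have hL0 : 0 < L := by linarith
  have hle : 1 / L * (h / A) ≤ 1 / 2 := by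
    have h1 : h / A ≤ 1 := (div_le_one hA).2 hhA
    have h2 : 1 / L ≤ 1 / 2 := one_div_le_one_div_of_le two_pos hL
    calc 1 / L * (h / A) ≤ 1 / 2 * 1 := by gcongr
      _ = 1 / 2 := mul_one _
  rw [blockLaw_apply _ _ _ measurableSet_Ioi]
  calc ENNReal.ofReal (1 / L * (h / A)) = volume (Ioo (1 - 1 / L * (h / A)) 1) := by
        rw [Real.volume_Ioo, sub_sub_cancel]
    _ ≤ _ := by
      refine measure_mono fun u hu => ?_
      have h1 : 1 / 2 ≤ u := by linarith [hu.1]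
      refine ⟨?_, by linarith, hu.2⟩
      have h2 := hslope u h1 hu.2.le
      have h3 : (1 - u) * (L * A) < h := by
        have e : 1 / L * (h / A) = h / (L * A) := by field_simp
        rw [← lt_div_iff₀ (by positivity), ← e]
        linarith [hu.1]
      change 2 ^ t * A - h < A * profile b t u
      nlinarith

lemma exists_concentration_error {b t : ℝ} (hb : 0 < b) (ht : 1 ≤ t) {a : ℕ → ℝ}
    (hpos : ∀ n, 0 < a n) (ha : Tendsto a atTop atTop) :
    ∃ ε : ℕ → ℝ, (∀ n, 0 ≤ ε n) ∧ Tendsto ε atTop (nhds 0) ∧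
      ∀ n s, blockLaw b t (a n) (Ioc s (s + 1)) ≤ ENNReal.ofReal (ε n) := by
  have hle1 (n : ℕ) : ⨆ s, blockLaw b t (a n) (Ioc s (s + 1)) ≤ 1 :=
    iSup_le fun s => prob_le_one
  refine ⟨fun n => (⨆ s, blockLaw b t (a n) (Ioc s (s + 1))).toReal,
    fun n => ENNReal.toReal_nonneg, ?_, fun n s => ?_⟩
  · rw [Metric.tendsto_atTop]
    intro e he
    set u₀ := min (e / 2) 1
    have hu₀ : 0 < u₀ := lt_min (by linarith) one_pos
    obtain ⟨c, L, hc, hcL⟩ := exists_profile_slope_bounds hb ht hu₀ (min_le_right _ _)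
    have hlim : Tendsto (fun n => 1 / c / a n) atTop (nhds 0) := ha.const_div_atTop _
    obtain ⟨N, hN⟩ := eventually_atTop.1
      (hlim.eventually (gt_mem_nhds (show 0 < e / 2 by linarith)))
    refine ⟨N, fun n hn => ?_⟩
    have han := hpos n
    have hbound : ⨆ s, blockLaw b t (a n) (Ioc s (s + 1)) ≤
        ENNReal.ofReal (u₀ + 1 / c / a n) :=
      iSup_le fun s => blockLaw_Ioc_le (hpos n) hc hu₀.le
        (fun u v h1 h2 h3 => (hcL u v h1 h2 h3).1) s
    have h1 := ENNReal.toReal_mono (by finiteness) hbound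
    rw [ENNReal.toReal_ofReal (by positivity)] at h1
    have h2 := hN n hn
    have h3 : u₀ ≤ e / 2 := min_le_left _ _
    rw [Real.dist_eq, sub_zero, abs_of_nonneg ENNReal.toReal_nonneg]
    linarith
  · rw [ENNReal.ofReal_toReal (ne_top_of_le_ne_top ENNReal.one_ne_top (hle1 n))]
    exact le_iSup (fun s => blockLaw b t (a n) (Ioc s (s + 1))) s

lemma map_profile_prod (b t : ℝ) (a q : ℕ → ℝ) :
    Measure.map (fun z : ℝ × ℝ => z.1 * (1 + z.2 ^ (1 / b)) ^ t)
      ((Measure.sum fun n => ENNReal.ofReal (q n) • Measure.dirac (a n)).prod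
        (volume.restrict (Ioo (0 : ℝ) 1))) =
      Measure.sum fun n => ENNReal.ofReal (q n) • blockLaw b t (a n) := by
  have hm : Measurable fun z : ℝ × ℝ => z.1 * (1 + z.2 ^ (1 / b)) ^ t :=
    measurable_fst.mul ((measurable_profile b t).comp measurable_snd)
  ext S hS
  rw [Measure.map_apply hm hS, Measure.prod_apply (hm hS), lintegral_sum_measure,
    Measure.sum_apply _ hS]
  refine tsum_congr fun n => ?_
  rw [lintegral_smul_measure, lintegral_dirac' _ (measurable_measure_prodMk_left (hm hS)),
    Measure.smul_apply, blockLaw, Measure.map_apply ((measurable_profile b t).const_mul _) hS]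
  rfl

lemma tower_pos {a r : ℝ} (ha : 1 < a) (n : ℕ) : 0 < a ^ (r ^ n) :=
  Real.rpow_pos_of_pos (by linarith) _

lemma le_tower {a r : ℝ} (ha : 1 < a) (hr : 1 ≤ r) (n : ℕ) : a ≤ a ^ (r ^ n) := by
  simpa using Real.rpow_le_rpow_of_exponent_le ha.le (one_le_pow₀ hr (n := n))

lemma tower_succ {a r : ℝ} (ha : 1 < a) (n : ℕ) : a ^ (r ^ (n + 1)) = (a ^ (r ^ n)) ^ r := by
  rw [pow_succ, Real.rpow_mul (by linarith)]

/-- For a distribution F in the family F₁(0) (ξ = η (1 + U^{1/b})^t), the convolution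
F * F is long-tailed even though F itself is not long-tailed. -/
theorem stmt15 (α b t r a : ℝ) (hα : α ∈ Set.Ico (1/2 : ℝ) 1) (hb : 0 < b) (ht : 1 ≤ t)
    (hr : r = 1 + 1/α) (ha : 1 < a) (ha2 : 2 ^ (t + 2) * a < a ^ r)
    (aseq : ℕ → ℝ) (haseq : ∀ n, aseq n = a ^ (r ^ n))
    (C : ℝ) (hC : C = (∑' n : ℕ, aseq n ^ (-α))⁻¹)
    (ηlaw : Measure ℝ)
    (hη : ηlaw = Measure.sum
      (fun n => ENNReal.ofReal (C * aseq n ^ (-α)) • Measure.dirac (aseq n)))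
    (Ulaw : Measure ℝ) (hU : Ulaw = MeasureTheory.volume.restrict (Set.Ioo (0:ℝ) 1))
    (F : Measure ℝ)
    (hF : F = Measure.map (fun q : ℝ × ℝ => q.1 * (1 + q.2 ^ (1/b)) ^ t)
      (ηlaw.prod Ulaw)) :
    LongTailed (mconv F F) ∧ ¬ LongTailed F := by
  obtain ⟨hα1, hα2⟩ := hα
  have hα0 : 0 < α := by linarith
  have hαinv : 1 ≤ 1 / α := (one_le_div hα0).2 hα2.le
  have hr1 : 1 ≤ r := by linarith
  have hrα : r * α = α + 1 := by rw [hr]; field_simp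
  have ha0 : 0 < a := by linarith
  have hpos (n : ℕ) : 0 < aseq n := haseq n ▸ tower_pos ha n
  have hge (n : ℕ) : a ≤ aseq n := haseq n ▸ le_tower ha hr1 n
  have hone (n : ℕ) : 1 ≤ aseq n := ha.le.trans (hge n)
  have hsucc (n : ℕ) : aseq (n + 1) = aseq n ^ r := by rw [haseq, haseq, tower_succ ha]
  have hB : (2 : ℝ) ≤ 2 ^ t := by
    simpa using Real.rpow_le_rpow_of_exponent_le (show (1 : ℝ) ≤ 2 by norm_num) ht
  have hgrowth (n : ℕ) : 4 * 2 ^ t * aseq n ≤ aseq (n + 1) := by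
    have h1 : (2 : ℝ) ^ (t + 2) = 4 * 2 ^ t := by
      rw [Real.rpow_add two_pos]
      norm_num
      ring
    have h2 (x : ℝ) (hx : 0 < x) : x ^ r = x ^ (r - 1) * x := by
      rw [Real.rpow_sub_one hx.ne', div_mul_cancel₀ _ hx.ne']
    have h3 : 4 * 2 ^ t < a ^ (r - 1) := by
      rw [h1, h2 a ha0] at ha2
      exact lt_of_mul_lt_mul_right ha2 ha0.le
    have h4 : a ^ (r - 1) ≤ aseq n ^ (r - 1) :=
      Real.rpow_le_rpow ha0.le (hge n) (by linarith)
    rw [hsucc, h2 _ (hpos n)]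
    have := hpos n
    gcongr
    linarith
  have htend : Tendsto aseq atTop atTop := by
    refine tendsto_atTop_mono (f := fun n : ℕ => (2 : ℝ) ^ n) (fun n => ?_)
      (tendsto_pow_atTop_atTop_of_one_lt (by norm_num))
    induction n with
    | zero => simpa using hone 0
    | succ n ih =>
      have := hgrowth n
      have := hpos n
      rw [pow_succ]
      nlinarith
  set q : ℕ → ℝ := fun n => aseq n ^ (-α) with hq
  have hqpos (n : ℕ) : 0 < q n := Real.rpow_pos_of_pos (hpos n) _
  have hqsucc (n : ℕ) : q (n + 1) = q n / aseq n := by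
    simp only [hq]
    rw [hsucc, ← Real.rpow_mul (hpos n).le, ← Real.rpow_sub_one (hpos n).ne']
    congr 1
    linarith
  have hqsum : Summable q := by
    refine summable_of_ratio_norm_eventually_le (r := 1 / a) ((div_lt_one ha0).2 ha)
      (Eventually.of_forall fun n => ?_)
    rw [Real.norm_of_nonneg (hqpos _).le, Real.norm_of_nonneg (hqpos _).le, hqsucc,
      one_div_mul_eq_div]
    exact div_le_div_of_nonneg_left (hqpos n).le ha0 (hge n)
  have hCpos : 0 < C := by
    rw [hC]
    exact inv_pos.2 (hqsum.tsum_pos (fun n => (hqpos n).le) 0 (hqpos 0))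
  set p : ℕ → ℝ := fun n => C * q n with hp
  have hpsum : ∑' n, ENNReal.ofReal (p n) = 1 := by
    have hne : ∑' n, q n ≠ 0 := (hqsum.tsum_pos (fun n => (hqpos n).le) 0 (hqpos 0)).ne'
    rw [← ENNReal.ofReal_tsum_of_nonneg (fun n => by have := hqpos n; positivity)
      (hqsum.mul_left C), tsum_mul_left, hC, inv_mul_cancel₀ hne, ENNReal.ofReal_one]
  have hFsum : F = Measure.sum fun n => ENNReal.ofReal (p n) • blockLaw b t (aseq n) := by
    rw [hF, hη, hU]
    exact map_profile_prod b t aseq p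
  have hFprob : IsProbabilityMeasure F := by
    refine ⟨?_⟩
    rw [hFsum, Measure.sum_apply _ MeasurableSet.univ]
    simpa using hpsum
  obtain ⟨ε, hε0, hε, hεle⟩ := exists_concentration_error hb ht hpos htend
  obtain ⟨c₁, _, hc₁, hslope₁⟩ := exists_profile_slope_bounds hb ht (u₀ := 1 / 4)
    (by norm_num) (by norm_num)
  obtain ⟨_, L, _, hslope₂⟩ := exists_profile_slope_bounds hb ht (u₀ := 1 / 2)
    (by norm_num) (by norm_num)
  have hmix : IsBlockMixture aseq p ε (fun n => blockLaw b t (aseq n)) F (2 ^ t)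
      (profile b t (1 / 2)) (profile b t (1 / 4)) (1 / c₁) (1 / max L 2) :=
    { prob := fun n => inferInstance
      prob_mixture := hFprob
      eq_sum := hFsum
      weight_pos := fun n => mul_pos hCpos (hqpos n)
      one_le := hone
      mem_block := fun n => ae_mem_blockLaw hb ht (hpos n)
      half_le := fun n => half_le_blockLaw hb ht (hpos n)
      concentration := hεle
      concentration_upper := fun n s => blockLaw_upper_le hb ht (hpos n) hc₁
        (fun u v h1 h2 h3 => (hslope₁ u v h1 h2 h3).1) s
      le_top := fun n x hx hxn => by
        refine le_blockLaw_top (hpos n) (le_max_right _ _) (fun u h1 h2 => ?_) hx hxn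
        rw [← profile_one b t]
        refine (hslope₂ u 1 h1 h2 le_rfl).2.trans ?_
        exact mul_le_mul_of_nonneg_right (le_max_left _ _) (by linarith)
      growth := hgrowth
      two_le := hB
      weight_succ := fun n => by simp only [hp, hqsucc, mul_div_assoc]
      threshold_lt := by
        have := (hslope₁ (1 / 4) (1 / 2) le_rfl (by norm_num) (by norm_num)).1
        linarith
      upper_pos := by positivity
      top_pos := by positivity
      error_nonneg := hε0 }
  refine ⟨hmix.longTailed_mconv htend ?_ ?_ ?_ hε, hmix.not_longTailed htend⟩
  · refine squeeze_zero (fun n => (div_pos (hpos n) (hpos _)).le) (fun n => ?_)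
      (tendsto_inv_atTop_zero.comp htend)
    have h1 : aseq n * aseq n ≤ aseq (n + 1) := by
      rw [hsucc, ← pow_two, ← Real.rpow_natCast]
      exact Real.rpow_le_rpow_of_exponent_le (hone n) (by push_cast; linarith)
    rw [Function.comp_apply, ← one_div, div_le_div_iff₀ (hpos _) (hpos n), one_mul]
    exact h1
  · simpa [hp] using hqsum.tendsto_atTop_zero.const_mul C
  · have h1 : Tendsto (fun n => C * aseq n ^ (1 - α)) atTop atTop :=
      ((tendsto_rpow_atTop (by linarith)).comp htend).const_mul_atTop hCpos
    refine h1.congr fun n => ?_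
    simp only [hp, hq]
    rw [mul_assoc, ← Real.rpow_add_one (hpos n).ne', neg_add_eq_sub]
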